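/- Let ν be a real number and let a, b, c be integers with a ≠ 0 and c ≠ 0, and suppose that θ = (a·ν + b)/c is irrational. If n is a positive integer and r, s are nonzero integers such that {nθ} = (r/s)·ν, then c divides n·b, the floor satisfies ⌊nθ⌋ = n·b/c, and consequently 0 < θ − b/c < 1/n. -/

import Mathlib

/-- Let `ν` be real and `a, b, c` integers with `a ≠ 0`, `c ≠ 0`, and suppose
`θ = (a·ν + b)/c` is irrational.  If `n` is a positive integer and `r, s` are nonzero integers
with `{nθ} = (r/s)·ν`, then `c ∣ n·b`, the floor satisfies `⌊nθ⌋ = n·b/c`, and consequently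
`0 < θ - b/c < 1/n`. -/
theorem floor_eq_and_theta_close (ν : ℝ) (a b c : ℤ) (ha : a ≠ 0) (hc : c ≠ 0)
    (θ : ℝ) (hθdef : θ = ((a : ℝ) * ν + (b : ℝ)) / (c : ℝ)) (hθ : Irrational θ)
    (n : ℕ) (hn : 0 < n) (r s : ℤ) (hr : r ≠ 0) (hs : s ≠ 0)
    (h : Int.fract ((n : ℝ) * θ) = ((r : ℝ) / (s : ℝ)) * ν) :
    c ∣ (n : ℤ) * b ∧
      ((⌊(n : ℝ) * θ⌋ : ℝ) = (n : ℝ) * (b : ℝ) / (c : ℝ)) ∧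
      0 < θ - (b : ℝ) / (c : ℝ) ∧ θ - (b : ℝ) / (c : ℝ) < 1 / (n : ℝ) := by
  have hcR : (c : ℝ) ≠ 0 := by exact_mod_cast hc
  have hsR : (s : ℝ) ≠ 0 := by exact_mod_cast hs
  have hnR : (0 : ℝ) < n := by exact_mod_cast hn
  have hfr : (⌊(n : ℝ) * θ⌋ : ℝ) + Int.fract ((n : ℝ) * θ) = n * θ := Int.floor_add_fract _
  have hf0 := Int.fract_nonneg ((n : ℝ) * θ)
  have hf1 := Int.fract_lt_one ((n : ℝ) * θ)
  generalize ⌊(n : ℝ) * θ⌋ = m at hfr ⊢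
  have hcθ : (c : ℝ) * θ = a * ν + b := by
    rw [hθdef]; field_simp
  have hsf : (s : ℝ) * Int.fract ((n : ℝ) * θ) = r * ν := by
    rw [h]; field_simp
  have key : ν * ((n : ℝ) * a * s - r * c) = s * (c * m - n * b) := by
    linear_combination (-(n : ℝ) * s) * hcθ - (s : ℝ) * c * hfr + (c : ℝ) * hsf
  have hD : (n : ℝ) * a * s - r * c = 0 := by
    by_contra hD
    apply hθ
    refine ⟨((a : ℚ) * (s * (c * m - n * b) / (n * a * s - r * c)) + b) / c, ?_⟩
    have hν : ν = s * (c * m - n * b) / ((n : ℝ) * a * s - r * c) := by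
      rw [eq_div_iff hD]; exact key
    rw [hθdef, hν]
    push_cast
    rfl
  have hm : (c : ℝ) * m = n * b := by
    rw [hD, mul_zero] at key
    rcases mul_eq_zero.mp key.symm with h1 | h1
    · exact absurd h1 hsR
    · linarith
  have hmq : (m : ℝ) = n * b / c := by
    rw [eq_div_iff hcR]; linarith
  have hfe : (n : ℝ) * (θ - b / c) = Int.fract ((n : ℝ) * θ) := by
    have : (n : ℝ) * (θ - b / c) = n * θ - n * b / c := by ring
    rw [this, ← hmq]; linarith
  have hne : θ - b / c ≠ 0 := by
    intro h0
    apply hθ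
    refine ⟨(b : ℚ) / c, ?_⟩
    push_cast
    linarith
  refine ⟨⟨m, by exact_mod_cast hm.symm⟩, hmq, ?_, ?_⟩
  · refine lt_of_le_of_ne ?_ hne.symm
    rw [← hfe] at hf0
    exact nonneg_of_mul_nonneg_right hf0 hnR
  · rw [lt_div_iff₀ hnR]
    linarith
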